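/- arXiv:2210.14333 — 2 statements merged into one kernel-verified Lean document; each statement's English description precedes it below -/
import Mathlib

section
/- Let Ω ⊆ ℝ^d be a bounded domain, X = {x_1,…,x_N} ⊆ Ω, h > 0, δ > 0, and let a_1,…,a_N : Ω → ℝ be functions that reproduce polynomials up to degree m on Ω, vanish outside the balls B(x_i, δ) (i.e. a_i(x) = 0 whenever ‖x − x_i‖₂ ≥ δ), and are |α|-times continuously differentiable for a fixed multi-index α with the bound |D^α a_i(x)| ≤ C_α h^{−|α|} for all x ∈ Ω and all i. Set I(x̂) = {j : ‖x̂ − x_j‖₂ < δ} and assume #I(x̂) ≤ M for a fixed x̂ ∈ Ω. Then for every p ∈ π_m(ℝ^d) and every f : Ω → ℝ that is |α|-times continuously differentiable, the quasi-interpolant Q_X(f) = Σ_{i=1}^N f(x_i) a_i satisfies |D^α f(x̂) − D^α Q_X(f)(x̂)| ≤ |D^α f(x̂) − D^α p(x̂)| + (1 + C_α M) h^{−|α|} · max_{j ∈ I(x̂)} |f(x_j) − p(x_j)|. -/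
open scoped BigOperators

/-- Partial derivative of `f : ℝ^d → ℝ` in the `j`-th coordinate direction. -/
noncomputable def coordDeriv {d : ℕ} (j : Fin d)
    (f : EuclideanSpace ℝ (Fin d) → ℝ) : EuclideanSpace ℝ (Fin d) → ℝ :=
  fun x => fderiv ℝ f x (EuclideanSpace.single j 1)

/-- Iterated partial derivative `D^α f` for a multi-index `α ∈ ℕ₀^d`. -/
noncomputable def multiDeriv {d : ℕ} (α : Fin d → ℕ)
    (f : EuclideanSpace ℝ (Fin d) → ℝ) : EuclideanSpace ℝ (Fin d) → ℝ :=
  (List.finRange d).foldr (fun j g => (coordDeriv j)^[α j] g) f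

/-- Iterated coordinate derivatives along a list of indices. -/
noncomputable def listDeriv {d : ℕ} (L : List (Fin d))
    (f : EuclideanSpace ℝ (Fin d) → ℝ) : EuclideanSpace ℝ (Fin d) → ℝ :=
  L.foldr coordDeriv f

theorem foldr_replicate_coordDeriv {d : ℕ} (j : Fin d) (k : ℕ)
    (f : EuclideanSpace ℝ (Fin d) → ℝ) :
    (List.replicate k j).foldr coordDeriv f = (coordDeriv j)^[k] f := by
  induction k with
  | zero => rfl
  | succ k ih => rw [List.replicate_succ, List.foldr_cons, ih, Function.iterate_succ_apply']

theorem multiDeriv_eq_listDeriv {d : ℕ} (α : Fin d → ℕ) :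
    ∃ L : List (Fin d), L.length = ∑ j, α j ∧ ∀ f, multiDeriv α f = listDeriv L f := by
  refine ⟨(List.finRange d).flatMap (fun j => List.replicate (α j) j), ?_, ?_⟩
  · rw [List.length_flatMap]
    simp [Fin.sum_univ_def]
  · intro f
    unfold multiDeriv listDeriv
    induction List.finRange d with
    | nil => rfl
    | cons j l ih =>
      rw [List.flatMap_cons, List.foldr_append, List.foldr_cons, ih,
        foldr_replicate_coordDeriv]

theorem coordDeriv_contDiffOn {d : ℕ} {Ω : Set (EuclideanSpace ℝ (Fin d))} (hΩ : IsOpen Ω)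
    (j : Fin d) (n : ℕ) {f : EuclideanSpace ℝ (Fin d) → ℝ}
    (hf : ContDiffOn ℝ ((n + 1 : ℕ) : WithTop ℕ∞) f Ω) :
    ContDiffOn ℝ (n : WithTop ℕ∞) (coordDeriv j f) Ω := by
  have h1 : ContDiffOn ℝ (n : WithTop ℕ∞) (fderiv ℝ f) Ω :=
    hf.fderiv_of_isOpen hΩ (by push_cast; exact le_rfl)
  exact h1.clm_apply contDiffOn_const

theorem listDeriv_contDiffOn {d : ℕ} {Ω : Set (EuclideanSpace ℝ (Fin d))} (hΩ : IsOpen Ω)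
    (L : List (Fin d)) : ∀ (n : ℕ) {f : EuclideanSpace ℝ (Fin d) → ℝ},
    ContDiffOn ℝ ((n + L.length : ℕ) : WithTop ℕ∞) f Ω →
    ContDiffOn ℝ (n : WithTop ℕ∞) (listDeriv L f) Ω := by
  induction L with
  | nil => intro n f hf; simpa [listDeriv] using hf
  | cons j l ih =>
    intro n f hf
    refine coordDeriv_contDiffOn hΩ j n (ih (n + 1) ?_)
    rw [List.length_cons] at hf
    rwa [show n + 1 + l.length = n + (l.length + 1) by omega]

theorem coordDeriv_congr {d : ℕ} {Ω : Set (EuclideanSpace ℝ (Fin d))} (hΩ : IsOpen Ω)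
    (j : Fin d) {f g : EuclideanSpace ℝ (Fin d) → ℝ} (hfg : Set.EqOn f g Ω) :
    Set.EqOn (coordDeriv j f) (coordDeriv j g) Ω := by
  intro x hx
  have : f =ᶠ[nhds x] g := Filter.eventually_of_mem (hΩ.mem_nhds hx) hfg
  simp only [coordDeriv, this.fderiv_eq]

theorem listDeriv_congr {d : ℕ} {Ω : Set (EuclideanSpace ℝ (Fin d))} (hΩ : IsOpen Ω)
    (L : List (Fin d)) {f g : EuclideanSpace ℝ (Fin d) → ℝ} (hfg : Set.EqOn f g Ω) :
    Set.EqOn (listDeriv L f) (listDeriv L g) Ω := by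
  induction L with
  | nil => exact hfg
  | cons j l ih => exact coordDeriv_congr hΩ j ih

theorem listDeriv_zero {d : ℕ} (L : List (Fin d)) :
    listDeriv L (fun _ => (0 : ℝ)) = fun _ => 0 := by
  induction L with
  | nil => rfl
  | cons j l ih =>
    change coordDeriv j (listDeriv l _) = _
    rw [ih]
    funext x
    simp [coordDeriv]

theorem listDeriv_sum {d N : ℕ} {Ω : Set (EuclideanSpace ℝ (Fin d))} (hΩ : IsOpen Ω)
    (a : Fin N → EuclideanSpace ℝ (Fin d) → ℝ) (c : Fin N → ℝ)
    (L : List (Fin d))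
    (ha : ∀ i, ContDiffOn ℝ (L.length : WithTop ℕ∞) (a i) Ω) :
    Set.EqOn (listDeriv L (fun x => ∑ i, c i * a i x))
      (fun x => ∑ i, c i * listDeriv L (a i) x) Ω := by
  induction L with
  | nil => intro x hx; rfl
  | cons j l ih =>
    have h1 : ∀ i, ContDiffOn ℝ ((1 : ℕ) : WithTop ℕ∞) (listDeriv l (a i)) Ω := fun i =>
      listDeriv_contDiffOn hΩ l 1 (by
        have := ha i
        rw [List.length_cons] at this
        rwa [add_comm])
    have h2 := ih (fun i => (ha i).of_le (by
      rw [List.length_cons]; exact_mod_cast Nat.le_succ _))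
    intro x hx
    refine (coordDeriv_congr hΩ j h2 hx).trans ?_
    have hd : ∀ i, DifferentiableAt ℝ (listDeriv l (a i)) x := fun i =>
      ((h1 i).differentiableOn (by simp)).differentiableAt (hΩ.mem_nhds hx)
    have hs : HasFDerivAt (fun x => ∑ i, c i * listDeriv l (a i) x)
        (∑ i, c i • fderiv ℝ (listDeriv l (a i)) x) x :=
      HasFDerivAt.fun_sum (fun i _ => (hd i).hasFDerivAt.const_mul (c i))
    change fderiv ℝ (fun x => ∑ i, c i * listDeriv l (a i) x) x (EuclideanSpace.single j 1) =
      ∑ i, c i * fderiv ℝ (listDeriv l (a i)) x (EuclideanSpace.single j 1)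
    rw [hs.fderiv]
    simp

theorem listDeriv_eq_zero_of_far {d : ℕ} {Ω : Set (EuclideanSpace ℝ (Fin d))} (hΩ : IsOpen Ω)
    (L : List (Fin d)) {f : EuclideanSpace ℝ (Fin d) → ℝ}
    (hf : ContDiffOn ℝ (L.length : WithTop ℕ∞) f Ω)
    (y : EuclideanSpace ℝ (Fin d)) {δ : ℝ} (hδ : 0 < δ)
    (hz : ∀ x, δ ≤ ‖x - y‖ → f x = 0) {x : EuclideanSpace ℝ (Fin d)} (hx : x ∈ Ω)
    (hxy : δ ≤ ‖x - y‖) : listDeriv L f x = 0 := by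
  have hopen : IsOpen {z : EuclideanSpace ℝ (Fin d) | δ < ‖z - y‖} :=
    isOpen_lt continuous_const (by fun_prop)
  have hfar : ∀ z, δ < ‖z - y‖ → listDeriv L f z = 0 := by
    intro z hzz
    have := listDeriv_congr hopen L (f := f) (g := fun _ => 0)
      (fun w hw => hz w (le_of_lt hw)) hzz
    rw [this, listDeriv_zero]
  have hc : ContinuousAt (listDeriv L f) x :=
    (listDeriv_contDiffOn hΩ L 0 (by simpa using hf)).continuousOn.continuousAt
      (hΩ.mem_nhds hx)
  have ht : Filter.Tendsto (fun t : ℝ => x + t • (x - y)) (nhdsWithin 0 (Set.Ioi 0))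
      (nhds x) := by
    have : Continuous (fun t : ℝ => x + t • (x - y)) := by fun_prop
    have h0 := this.tendsto 0
    simp only [zero_smul, add_zero] at h0
    exact h0.mono_left nhdsWithin_le_nhds
  have h1 := hc.tendsto.comp ht
  refine tendsto_nhds_unique h1 (tendsto_const_nhds.congr' ?_)
  filter_upwards [self_mem_nhdsWithin] with t ht
  have ht' : 0 < t := ht
  symm
  apply hfar
  have : x + t • (x - y) - y = (1 + t) • (x - y) := by
    rw [add_smul, one_smul]; abel
  rw [this, norm_smul, Real.norm_of_nonneg (by linarith)]
  nlinarith

/-- Stability estimate for the quasi-interpolant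
`Q_X(f) = Σ_i f(x_i) a_i`: if the `a_i` reproduce polynomials of degree `≤ m` on
`Ω`, vanish outside the balls `B(x_i, δ)`, and satisfy
`|D^α a_i| ≤ C_α h^{−|α|}` on `Ω`, and if `I(x̂) = {j : ‖x̂ − x_j‖ < δ}` has at
most `M` elements, then for every polynomial `p ∈ π_m(ℝ^d)` and every
`|α|`-times continuously differentiable `f`,
`|D^α f(x̂) − D^α Q_X(f)(x̂)| ≤ |D^α f(x̂) − D^α p(x̂)|
  + (1 + C_α M) h^{−|α|} max_{j ∈ I(x̂)} |f(x_j) − p(x_j)|`. -/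
theorem quasi_interpolation_pointwise_estimate (d N m : ℕ)
    (Ω : Set (EuclideanSpace ℝ (Fin d)))
    (hΩo : IsOpen Ω) (hΩb : Bornology.IsBounded Ω) (hΩne : Ω.Nonempty)
    (pts : Fin N → EuclideanSpace ℝ (Fin d)) (hpts : ∀ i, pts i ∈ Ω)
    (h δ Cα : ℝ) (hh : 0 < h) (hδ : 0 < δ) (hCα : 0 ≤ Cα)
    (a : Fin N → EuclideanSpace ℝ (Fin d) → ℝ) (α : Fin d → ℕ)
    (hrep : ∀ p : MvPolynomial (Fin d) ℝ, p.totalDegree ≤ m →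
      ∀ x ∈ Ω, ∑ i, MvPolynomial.eval (fun j => pts i j) p * a i x =
        MvPolynomial.eval (fun j => x j) p)
    (hsupp : ∀ i, ∀ x : EuclideanSpace ℝ (Fin d), δ ≤ ‖x - pts i‖ → a i x = 0)
    (hsmooth : ∀ i, ContDiffOn ℝ (∑ j, α j) (a i) Ω)
    (hbound : ∀ i, ∀ x ∈ Ω, |multiDeriv α (a i) x| ≤ Cα / h ^ (∑ j, α j))
    (M : ℕ) (xh : EuclideanSpace ℝ (Fin d)) (hxh : xh ∈ Ω)
    (hM : ({j : Fin N | ‖xh - pts j‖ < δ}.ncard) ≤ M)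
    (p : MvPolynomial (Fin d) ℝ) (hp : p.totalDegree ≤ m)
    (f : EuclideanSpace ℝ (Fin d) → ℝ) (hf : ContDiffOn ℝ (∑ j, α j) f Ω) :
    |multiDeriv α f xh -
        multiDeriv α (fun x => ∑ i, f (pts i) * a i x) xh| ≤
      |multiDeriv α f xh -
          multiDeriv α (fun x => MvPolynomial.eval (fun j => x j) p) xh| +
        (1 + Cα * M) / h ^ (∑ j, α j) *
          sSup {v : ℝ | ∃ j : Fin N, ‖xh - pts j‖ < δ ∧
            v = |f (pts j) - MvPolynomial.eval (fun l => pts j l) p|} := by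
  obtain ⟨L, hL, hmd⟩ := multiDeriv_eq_listDeriv α
  have ha : ∀ i, ContDiffOn ℝ (L.length : WithTop ℕ∞) (a i) Ω := by
    intro i
    have := hsmooth i
    rw [hL]
    push_cast
    exact this
  have hQ := listDeriv_sum hΩo a (fun i => f (pts i)) L ha hxh
  have hP := listDeriv_sum hΩo a
    (fun i => MvPolynomial.eval (fun j => pts i j) p) L ha hxh
  have hPc := listDeriv_congr hΩo L (fun x hx => hrep p hp x hx) hxh
  simp only [hmd] at hbound ⊢
  rw [hPc] at hP
  set S := sSup {v : ℝ | ∃ j : Fin N, ‖xh - pts j‖ < δ ∧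
            v = |f (pts j) - MvPolynomial.eval (fun l => pts j l) p|} with hS
  have hbdd : BddAbove {v : ℝ | ∃ j : Fin N, ‖xh - pts j‖ < δ ∧
      v = |f (pts j) - MvPolynomial.eval (fun l => pts j l) p|} := by
    apply Set.Finite.bddAbove
    refine (Set.finite_range (fun j : Fin N =>
      |f (pts j) - MvPolynomial.eval (fun l => pts j l) p|)).subset ?_
    rintro v ⟨j, -, rfl⟩
    exact ⟨j, rfl⟩
  have hS0 : 0 ≤ S := by
    apply Real.sSup_nonneg
    rintro v ⟨j, -, rfl⟩
    exact abs_nonneg _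
  have hH : 0 < h ^ (∑ j, α j) := pow_pos hh _
  have hmain : |listDeriv L (fun x => MvPolynomial.eval (fun j => x j) p) xh -
      listDeriv L (fun x => ∑ i, f (pts i) * a i x) xh| ≤
      (1 + Cα * M) / h ^ (∑ j, α j) * S := by
    rw [hP, hQ, abs_sub_comm, ← Finset.sum_sub_distrib]
    classical
    have hterm : ∀ i ∈ (Finset.univ : Finset (Fin N)),
        |f (pts i) * listDeriv L (a i) xh -
          MvPolynomial.eval (fun j => pts i j) p * listDeriv L (a i) xh| ≤
        if ‖xh - pts i‖ < δ then S * (Cα / h ^ (∑ j, α j)) else 0 := by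
      intro i _
      rw [← sub_mul, abs_mul]
      split_ifs with hi
      · exact mul_le_mul (le_csSup hbdd ⟨i, hi, rfl⟩) (hbound i xh hxh) (abs_nonneg _) hS0
      · rw [listDeriv_eq_zero_of_far hΩo L (ha i) (pts i) hδ (hsupp i) hxh (not_lt.mp hi)]
        simp
    refine (Finset.abs_sum_le_sum_abs _ _).trans ((Finset.sum_le_sum hterm).trans ?_)
    rw [← Finset.sum_filter, Finset.sum_const, nsmul_eq_mul]
    have hcard : ((Finset.univ.filter (fun i : Fin N => ‖xh - pts i‖ < δ)).card : ℝ) ≤ M := by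
      rw [← Set.ncard_coe_finset]
      simp only [Finset.coe_filter, Finset.mem_univ, true_and]
      exact_mod_cast hM
    have hB : 0 ≤ S * (Cα / h ^ (∑ j, α j)) := by positivity
    refine (mul_le_mul_of_nonneg_right hcard hB).trans ?_
    have : (1 + Cα * M) / h ^ (∑ j, α j) * S =
      S / h ^ (∑ j, α j) + M * (S * (Cα / h ^ (∑ j, α j))) := by ring
    rw [this]
    have : 0 ≤ S / h ^ (∑ j, α j) := by positivity
    linarith
  exact (abs_sub_le _ _ _).trans (add_le_add le_rfl hmain)
end

section
/- Let Ω ⊆ ℝ^d be a bounded domain, k ∈ ℕ, C₀, C₁ > 0, μ ∈ (0,1), h₀ > 0, and set h_j = μ^j h₀ for j ≥ 1. For each j ≥ 1 let Q_j be a map from C^k(Ω̄) to C^k(Ω̄) satisfying, for all g ∈ C^k(Ω̄), both ‖g − Q_j(g)‖_{C(Ω̄)} ≤ C₀ h_j^k ‖g‖_{C^k(Ω̄)} and ‖g − Q_j(g)‖_{C^k(Ω̄)} ≤ C₁ ‖g‖_{C^k(Ω̄)}. Given f ∈ C^k(Ω̄), define e₀ = f, f₀ = 0, and for j = 1,…,n: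 s_j = Q_j(e_{j−1}), f_j = f_{j−1} + s_j, e_j = e_{j−1} − s_j. Then for every n ≥ 1, ‖f − f_n‖_{C(Ω̄)} ≤ (C₀ h₀^k / C₁) (C₁ μ^k)^n ‖f‖_{C^k(Ω̄)}. In particular, the multiscale quasi-interpolation scheme converges whenever C₁ μ^k < 1. -/
open scoped BigOperators

/-- The `C^k(Ω̄)` norm `max_{|α| ≤ k} sup_{x ∈ Ω} |D^α u(x)|`; for `k = 0` this is
the sup norm `‖·‖_{C(Ω̄)}`. -/
noncomputable def CkNorm {d : ℕ} (k : ℕ) (Ω : Set (EuclideanSpace ℝ (Fin d)))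
    (u : EuclideanSpace ℝ (Fin d) → ℝ) : ℝ :=
  sSup {v : ℝ | ∃ α : Fin d → ℕ, (∑ j, α j) ≤ k ∧ ∃ x ∈ Ω, v = |multiDeriv α u x|}

/-- Convergence of the multiscale quasi-interpolation scheme:
with fill distances `h_j = μ^j h₀`, level operators `Q_j` satisfying
`‖g − Q_j g‖_{C(Ω̄)} ≤ C₀ h_j^k ‖g‖_{C^k(Ω̄)}` and
`‖g − Q_j g‖_{C^k(Ω̄)} ≤ C₁ ‖g‖_{C^k(Ω̄)}`, and the residual-correction scheme
`f₀ = 0`, `e₀ = f`, `s_j = Q_j(e_{j−1})`, `f_j = f_{j−1} + s_j`,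
`e_j = e_{j−1} − s_j`, one has for every `n ≥ 1`
`‖f − f_n‖_{C(Ω̄)} ≤ (C₀ h₀^k / C₁) (C₁ μ^k)^n ‖f‖_{C^k(Ω̄)}`;
in particular the scheme converges whenever `C₁ μ^k < 1`. -/
theorem multiscale_convergence (d k : ℕ) (hk : 1 ≤ k)
    (Ω : Set (EuclideanSpace ℝ (Fin d)))
    (hΩo : IsOpen Ω) (hΩb : Bornology.IsBounded Ω) (hΩne : Ω.Nonempty)
    (C₀ C₁ : ℝ) (hC₀ : 0 < C₀) (hC₁ : 0 < C₁)
    (μ h₀ : ℝ) (hμ : μ ∈ Set.Ioo (0 : ℝ) 1) (hh₀ : 0 < h₀)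
    (Q : ℕ → (EuclideanSpace ℝ (Fin d) → ℝ) → (EuclideanSpace ℝ (Fin d) → ℝ))
    (hQmap : ∀ j, 1 ≤ j → ∀ g : EuclideanSpace ℝ (Fin d) → ℝ,
      ContDiffOn ℝ k g Ω → ContDiffOn ℝ k (Q j g) Ω)
    (hQ0 : ∀ j, 1 ≤ j → ∀ g : EuclideanSpace ℝ (Fin d) → ℝ, ContDiffOn ℝ k g Ω →
      CkNorm 0 Ω (fun x => g x - Q j g x) ≤ C₀ * (μ ^ j * h₀) ^ k * CkNorm k Ω g)
    (hQk : ∀ j, 1 ≤ j → ∀ g : EuclideanSpace ℝ (Fin d) → ℝ, ContDiffOn ℝ k g Ω →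
      CkNorm k Ω (fun x => g x - Q j g x) ≤ C₁ * CkNorm k Ω g)
    (f : EuclideanSpace ℝ (Fin d) → ℝ) (hf : ContDiffOn ℝ k f Ω)
    (fs es : ℕ → EuclideanSpace ℝ (Fin d) → ℝ)
    (hfs0 : fs 0 = fun _ => 0) (hes0 : es 0 = f)
    (hfsS : ∀ j, 1 ≤ j → fs j = fun x => fs (j - 1) x + Q j (es (j - 1)) x)
    (hesS : ∀ j, 1 ≤ j → es j = fun x => es (j - 1) x - Q j (es (j - 1)) x) :
    ∀ n : ℕ, 1 ≤ n →
      CkNorm 0 Ω (fun x => f x - fs n x) ≤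
        (C₀ * h₀ ^ k / C₁) * (C₁ * μ ^ k) ^ n * CkNorm k Ω f := by
  have hS : ∀ m, es (m + 1) = fun x => es m x - Q (m + 1) (es m) x := fun m => by
    simpa using hesS (m + 1) (by omega)
  have hF : ∀ m, fs (m + 1) = fun x => fs m x + Q (m + 1) (es m) x := fun m => by
    simpa using hfsS (m + 1) (by omega)
  have hreg : ∀ m, ContDiffOn ℝ k (es m) Ω := by
    intro m
    induction m with
    | zero => rw [hes0]; exact hf
    | succ m ih =>
      rw [hS]
      exact ih.sub (hQmap (m + 1) (by omega) _ ih)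
  have herr : ∀ m, (fun x => f x - fs m x) = es m := by
    intro m
    induction m with
    | zero => rw [hes0, hfs0]; simp
    | succ m ih =>
      rw [hS, hF, ← ih]
      funext x
      ring
  have hbd : ∀ m, CkNorm k Ω (es m) ≤ C₁ ^ m * CkNorm k Ω f := by
    intro m
    induction m with
    | zero => rw [hes0]; simp
    | succ m ih =>
      have h1 := hQk (m + 1) (by omega) _ (hreg m)
      rw [hS]
      calc _ ≤ _ := h1
        _ ≤ C₁ * (C₁ ^ m * CkNorm k Ω f) := mul_le_mul_of_nonneg_left ih hC₁.le
        _ = _ := by ring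
  intro n hn
  obtain ⟨m, rfl⟩ : ∃ m, n = m + 1 := ⟨n - 1, by omega⟩
  have hμ0 : 0 < μ := hμ.1
  rw [herr, hS]
  calc _ ≤ _ := hQ0 (m + 1) (by omega) _ (hreg m)
    _ ≤ C₀ * (μ ^ (m + 1) * h₀) ^ k * (C₁ ^ m * CkNorm k Ω f) :=
      mul_le_mul_of_nonneg_left (hbd m) (by positivity)
    _ = _ := by
      rw [mul_pow, mul_pow, ← pow_mul, ← pow_mul, mul_comm k (m + 1), pow_succ C₁]
      field_simp
end
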